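/- arXiv:1605.01319 — 5 statements merged into one kernel-verified Lean document; each statement's English description precedes it below -/
import Mathlib

section
/- Let x : ZMod 20 → Bool. There exists y : ZMod 20 → Bool such that for every i ∈ ZMod 20 the following clauses hold — if the canonical representative of i is odd: (x i = true ∨ y i = true) and (x i = false ∨ y (i−1) = false); if the canonical representative of i is even: (x i = true ∨ y (i−1) = false) and (x i = false ∨ y i = true) — if and only if either (for all i ∈ ZMod 20, x i = true exactly when the canonical representative of i is even) or (for all i ∈ ZMod 20, x i = true exactly when the canonical representative of i is odd). -/
theorem stmt_2 (x : ZMod 20 → Bool) :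
    (∃ y : ZMod 20 → Bool, ∀ i : ZMod 20,
        (Odd i.val →
          (x i = true ∨ y i = true) ∧ (x i = false ∨ y (i - 1) = false)) ∧
        (Even i.val →
          (x i = true ∨ y (i - 1) = false) ∧ (x i = false ∨ y i = true))) ↔
      ((∀ i : ZMod 20, x i = true ↔ Even i.val) ∨
       (∀ i : ZMod 20, x i = true ↔ Odd i.val)) := by
  constructor
  · rintro ⟨y, hy⟩
    have up : ∀ i : ZMod 20, (x i = true ↔ Even i.val) → y i = true := by
      intro i hz
      have h := hy i
      rcases Nat.even_or_odd i.val with he | ho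
      · have := hz.2 he
        have := (h.2 he).2
        simp_all
      · have hx : ¬ x i = true := fun h' => (Nat.not_even_iff_odd.2 ho) (hz.1 h')
        exact (h.1 ho).1.resolve_left hx
    have down : ∀ i : ZMod 20, y (i - 1) = true → (x i = true ↔ Even i.val) := by
      intro i hz
      have h := hy i
      rcases Nat.even_or_odd i.val with he | ho
      · have := (h.2 he).1
        simp_all
      · have := (h.1 ho).2
        have := Nat.not_even_iff_odd.2 ho
        simp_all
    by_cases hex : ∃ i : ZMod 20, (x i = true ↔ Even i.val)
    · left
      obtain ⟨i, hi⟩ := hex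
      have key : ∀ n : ℕ, (x (i + n) = true ↔ Even (i + n : ZMod 20).val) := by
        intro n
        induction n with
        | zero => simpa using hi
        | succ k ih =>
          apply down
          have e : (i + ((k + 1 : ℕ) : ZMod 20) - 1) = i + k := by push_cast; ring
          rw [e]
          exact up _ ih
      intro j
      have h := key (j - i).val
      have e : i + (((j - i).val : ℕ) : ZMod 20) = j := by
        rw [ZMod.natCast_zmod_val]; ring
      rwa [e] at h
    · right
      intro i
      have h : ¬ (x i = true ↔ Even i.val) := fun h => hex ⟨i, h⟩
      rw [← Nat.not_even_iff_odd]
      tauto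
  · rintro (h | h)
    · refine ⟨fun _ => true, fun i => ⟨fun ho => ?_, fun he => ?_⟩⟩
      · have h1 : x i = false := by
          rw [← Bool.not_eq_true, h i]
          exact Nat.not_even_iff_odd.2 ho
        simp [h1]
      · have := (h i).2 he
        simp_all
    · refine ⟨fun _ => false, fun i => ⟨fun ho => ?_, fun he => ?_⟩⟩
      · have := (h i).2 ho
        simp_all
      · have h1 : x i = false := by
          rw [← Bool.not_eq_true, h i]
          exact Nat.not_odd_iff_even.2 he
        simp [h1]
end

section
/- Let V be a set of Boolean variables and let a 3-CNF formula over V be given as a finite family of clauses c : I → Finset (V × Bool) such that each clause consists of exactly 3 literals on 3 pairwise distinct variables. If every variable occurs (positively or negatively) in at most 2 of the clauses, then the formula is satisfiable: there exists an assignment a : V → Bool such that every clause contains a literal (v, b) with a v = b. -/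
theorem stmt_4 {V I : Type*} [Fintype I] [DecidableEq V]
    (c : I → Finset (V × Bool))
    (hthree : ∀ i : I, (c i).card = 3)
    (hdistinct : ∀ i : I, ((c i).image Prod.fst).card = 3)
    (hocc : ∀ v : V,
      (Finset.univ.filter (fun i : I => ∃ b : Bool, (v, b) ∈ c i)).card ≤ 2) :
    ∃ a : V → Bool, ∀ i : I, ∃ l ∈ c i, a l.1 = l.2 := by
  obtain ⟨f, hf, hfm⟩ := (Finset.all_card_le_biUnion_card_iff_exists_injective
    (fun i => (c i).image Prod.fst)).1 (by
      intro s
      have h := Finset.card_mul_le_card_mul (s := s)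
        (t := s.biUnion (fun i => (c i).image Prod.fst))
        (fun i v => v ∈ (c i).image Prod.fst) (m := 3) (n := 2) (by
          intro i hi
          rw [← hdistinct i]
          apply Finset.card_le_card
          intro v hv
          rw [Finset.mem_bipartiteAbove]
          exact ⟨Finset.mem_biUnion.2 ⟨i, hi, hv⟩, hv⟩) (by
          intro v _
          refine le_trans (Finset.card_le_card ?_) (hocc v)
          intro i hi
          rw [Finset.mem_bipartiteBelow] at hi
          obtain ⟨l, hl, rfl⟩ := Finset.mem_image.1 hi.2
          exact Finset.mem_filter.2 ⟨Finset.mem_univ _, l.2, hl⟩)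
      omega)
  have h2 : ∀ i, ∃ b, (f i, b) ∈ c i := by
    intro i
    obtain ⟨l, hl, h⟩ := Finset.mem_image.1 (hfm i)
    exact ⟨l.2, h ▸ hl⟩
  choose g hg using h2
  refine ⟨Function.extend f g (fun _ => true), fun i => ⟨(f i, g i), hg i, ?_⟩⟩
  exact hf.extend_apply g _ i
end

section
/- Let k ≥ 3 and let G be a finite k-regular simple graph. Define the graph 𝒥ₖ as follows. Its vertices are: all incidences (v, e) with v ∈ V(G) an endpoint of the edge e ∈ E(G), together with k−1 copies (e, 1), …, (e, k−1) of each edge e ∈ E(G). Its edges are: any two distinct incidences (v, e), (v, e') at the same vertex v are adjacent; any two distinct copies (e, i), (e, i') of the same edge e are adjacent; and each incidence (v, e) is adjacent to every copy (e, i), i ∈ {1, …, k−1}, of its edge e. Then the vertex set of 𝒥ₖ can be partitioned into k+1 independent dominating sets. -/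
/-- A set of vertices that is both independent and dominating. -/
def IsIndepDomSet {W : Type*} (H : SimpleGraph W) (D : Set W) : Prop :=
  (∀ u ∈ D, ∀ v ∈ D, ¬ H.Adj u v) ∧ (∀ v ∉ D, ∃ u ∈ D, H.Adj u v)

/-- The vertex type of the Heggernes–Telle graph 𝒥ₖ: incidences `(v, e)` with `v` an
endpoint of the edge `e`, together with `k - 1` copies of each edge. -/
def JVert {V : Type*} (G : SimpleGraph V) (k : ℕ) : Type _ :=
  {p : V × G.edgeSet // p.1 ∈ (p.2 : Sym2 V)} ⊕ (G.edgeSet × Fin (k - 1))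

/-- The Heggernes–Telle graph 𝒥ₖ: two distinct incidences at the same vertex are adjacent,
two distinct copies of the same edge are adjacent, and each incidence of an edge is adjacent
to every copy of that edge. -/
def JGraph {V : Type*} (G : SimpleGraph V) (k : ℕ) : SimpleGraph (JVert G k) :=
  SimpleGraph.fromRel (fun a b =>
    match a, b with
    | Sum.inl x, Sum.inl y => x.1.1 = y.1.1 ∧ x.1.2 ≠ y.1.2
    | Sum.inl x, Sum.inr y => x.1.2 = y.1
    | Sum.inr x, Sum.inl y => y.1.2 = x.1
    | Sum.inr x, Sum.inr y => x.1 = y.1 ∧ x.2 ≠ y.2)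

def HGood {V : Type*} (G : SimpleGraph V) {k : ℕ} (A : V → V → Fin k) (S : Set V) : Prop :=
  (∀ v ∈ S, ∀ a b, G.Adj v a → G.Adj v b → A v a = A v b → a = b) ∧
  (∀ u ∈ S, ∀ v ∈ S, G.Adj u v → A u v ≠ A v u)

theorem hall_aux {N : Type*} [Fintype N] {k : ℕ} (hN : Fintype.card N = k) (hk : 2 ≤ k)
    (forb : N → Option (Fin k)) (h : ¬ ∃ c, ∀ w, forb w = some c) :
    ∃ f : N → Fin k, Function.Injective f ∧ ∀ w, forb w ≠ some (f w) := by
  classical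
  let t : N → Finset (Fin k) := fun w => Finset.univ.filter (fun c => forb w ≠ some c)
  have key : ∀ s : Finset N, s.card ≤ (s.biUnion t).card := by
    intro s
    by_cases hfull : s.biUnion t = Finset.univ
    · rw [hfull, Finset.card_univ, Fintype.card_fin, ← hN]
      exact Finset.card_le_univ s
    · obtain ⟨c, hc⟩ : ∃ c, c ∉ s.biUnion t := by
        by_contra! hcon
        exact hfull (Finset.eq_univ_iff_forall.2 hcon)
      have hs : ∀ w ∈ s, forb w = some c := by
        intro w hw
        by_contra hne
        exact hc (Finset.mem_biUnion.2 ⟨w, hw, by simp [t, hne]⟩)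
      obtain ⟨w0, hw0⟩ : ∃ w, w ∉ s := by
        by_contra! hcon
        exact h ⟨c, fun w => hs w (hcon w)⟩
      have hlt : s.card < k := by
        rw [← hN]
        exact Finset.card_lt_univ_of_notMem hw0
      rcases s.eq_empty_or_nonempty with rfl | ⟨w, hw⟩
      · simp
      · have hsub : (Finset.univ.erase c) ⊆ s.biUnion t := by
          intro d hd
          refine Finset.mem_biUnion.2 ⟨w, hw, ?_⟩
          have hdc : d ≠ c := Finset.ne_of_mem_erase hd
          simp only [t, Finset.mem_filter, Finset.mem_univ, true_and, hs w hw]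
          intro hh
          exact hdc (Option.some.inj hh).symm
        have := Finset.card_le_card hsub
        rw [Finset.card_erase_of_mem (Finset.mem_univ c), Finset.card_univ, Fintype.card_fin] at this
        omega
  obtain ⟨f, hf, hft⟩ := (Finset.all_card_le_biUnion_card_iff_exists_injective t).1 key
  refine ⟨f, hf, fun w => ?_⟩
  have := hft w
  simpa [t] using this

theorem step_aux {V : Type*} [Fintype V] (G : SimpleGraph V) [DecidableRel G.Adj]
    {k : ℕ} (hk : 3 ≤ k) (hreg : G.IsRegularOfDegree k) (A : V → V → Fin k) (S : Set V)
    (hA : HGood G A S) (v : V) (hv : v ∉ S) (forb : V → Option (Fin k))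
    (hforb : ∀ w ∈ S, G.Adj v w → forb w = some (A w v))
    (h : ¬ ∃ c, ∀ w, G.Adj v w → forb w = some c) :
    ∃ A' : V → V → Fin k, HGood G A' (insert v S) ∧ (∀ u, u ≠ v → A' u = A u) ∧
      ∀ w, G.Adj v w → forb w ≠ some (A' v w) := by
  classical
  have hN : Fintype.card (G.neighborSet v) = k := by
    rw [SimpleGraph.card_neighborSet_eq_degree]; exact hreg v
  obtain ⟨f, hf, hff⟩ := hall_aux hN (by omega) (fun w : G.neighborSet v => forb w.1) (by
    rintro ⟨c, hc⟩
    exact h ⟨c, fun w hw => hc ⟨w, hw⟩⟩)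
  let g : V → Fin k := fun w => if hw : G.Adj v w then f ⟨w, hw⟩ else ⟨0, by omega⟩
  have hg : ∀ w (hw : G.Adj v w), g w = f ⟨w, hw⟩ := fun w hw => by simp [g, hw]
  refine ⟨Function.update A v g, ⟨?_, ?_⟩, ?_, ?_⟩
  · intro u hu a b ha hb hab
    by_cases huv : u = v
    · subst huv
      rw [Function.update_self, hg a ha, hg b hb] at hab
      exact congrArg Subtype.val (hf hab)
    · rw [Function.update_of_ne huv] at hab
      exact hA.1 u (hu.resolve_left huv) a b ha hb hab
  · have base : ∀ w ∈ S, G.Adj v w → g w ≠ A w v := by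
      intro w hw hvw heq
      apply hff ⟨w, hvw⟩
      rw [hforb w hw hvw, ← heq, hg w hvw]
    intro u hu w hw huw
    by_cases huv : u = v
    · subst huv
      have hwu : w ≠ u := huw.ne'
      rw [Function.update_self, Function.update_of_ne hwu]
      exact base w (hw.resolve_left hwu) huw
    · by_cases hwv : w = v
      · subst hwv
        rw [Function.update_self, Function.update_of_ne huv]
        exact (base u (hu.resolve_left huv) huw.symm).symm
      · rw [Function.update_of_ne huv, Function.update_of_ne hwv]
        exact hA.2 u (hu.resolve_left huv) w (hw.resolve_left hwv) huw
  · intro u hu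
    exact Function.update_of_ne hu _ _
  · intro w hw
    rw [Function.update_self, hg w hw]
    exact hff ⟨w, hw⟩

theorem closer_aux {V : Type*} (H : SimpleGraph V) {z v : V} (h : H.Reachable v z) (hne : v ≠ z) :
    ∃ w, H.Adj v w ∧ H.Reachable w z ∧ H.dist w z < H.dist v z := by
  obtain ⟨p, hp⟩ := h.exists_walk_length_eq_dist
  cases p with
  | nil => exact absurd rfl hne
  | cons hadj q =>
    refine ⟨_, hadj, ⟨q⟩, ?_⟩
    have := SimpleGraph.dist_le q
    simp at hp
    omega

theorem three_nbrs {V : Type*} [Fintype V] (G : SimpleGraph V) [DecidableRel G.Adj]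
    {k : ℕ} (hk : 3 ≤ k) (hreg : G.IsRegularOfDegree k) (r : V) :
    ∃ x y z, G.Adj r x ∧ G.Adj r y ∧ G.Adj r z ∧ x ≠ y ∧ x ≠ z ∧ y ≠ z := by
  classical
  have h : 2 < (G.neighborFinset r).card := by
    rw [SimpleGraph.card_neighborFinset_eq_degree, hreg r]; omega
  obtain ⟨x, y, z, hx, hy, hz, h1, h2, h3⟩ := Finset.two_lt_card_iff.1 h
  simp only [SimpleGraph.mem_neighborFinset] at hx hy hz
  exact ⟨x, y, z, hx, hy, hz, h1, h2, h3⟩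

theorem comp_aux {V : Type*} [Fintype V] (G : SimpleGraph V) [DecidableRel G.Adj]
    {k : ℕ} (hk : 3 ≤ k) (hreg : G.IsRegularOfDegree k) (x : V) :
    ∃ A : V → V → Fin k, HGood G A {w | G.Reachable w x} := by
  classical
  obtain ⟨r, hrx, hrmax⟩ : ∃ r, G.Reachable r x ∧
      ∀ w, G.Reachable w x → G.dist w x ≤ G.dist r x := by
    obtain ⟨r, hr, hmax⟩ := Finset.exists_max_image
      (Finset.univ.filter (fun w => G.Reachable w x)) (fun w => G.dist w x) ⟨x, by simp⟩
    exact ⟨r, by simpa using hr, fun w hw => hmax w (by simpa using hw)⟩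
  obtain ⟨x1, x2, z, hx1, hx2, hz, h12, h1z, h2z⟩ := three_nbrs G hk hreg r
  let H : SimpleGraph V :=
    { Adj := fun a b => G.Adj a b ∧ a ≠ r ∧ b ≠ r
      symm := ⟨fun a b h => ⟨h.1.symm, h.2.2, h.2.1⟩⟩
      loopless := ⟨fun a h => h.1.ne rfl⟩ }
  have hHx : ∀ n w, G.dist w x = n → G.Reachable w x → w ≠ r → H.Reachable w x := by
    intro n
    induction n using Nat.strong_induction_on with
    | _ n ih =>
      intro w hwn hw hwr
      by_cases hwx : w = x
      · subst hwx; exact SimpleGraph.Reachable.refl _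
      · obtain ⟨w', hadj, hreach, hlt⟩ := closer_aux G hw hwx
        have hw'r : w' ≠ r := by
          rintro rfl
          have := hrmax w hw
          omega
        have h1 : H.Adj w w' := ⟨hadj, hwr, hw'r⟩
        exact h1.reachable.trans (ih _ (hwn ▸ hlt) w' rfl hreach hw'r)
  have hzx : G.Reachable z x := hz.symm.reachable.trans hrx
  have hHz : ∀ w, G.Reachable w x → w ≠ r → H.Reachable w z := fun w hw hwr =>
    (hHx _ w rfl hw hwr).trans (hHx _ z rfl hzx hz.ne').symm
  have main : ∀ n, ∀ U : Finset V, U.card = n →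
      (∀ u ∈ U, G.Reachable u x ∧ u ≠ r ∧ u ≠ z) →
      ∃ A : V → V → Fin k, HGood G A (U : Set V) ∧ (x1 ∈ U → x2 ∈ U → A x1 r ≠ A x2 r) := by
    intro n
    induction n with
    | zero =>
      intro U hU _
      rw [Finset.card_eq_zero] at hU
      subst hU
      exact ⟨fun _ _ => ⟨0, by omega⟩, ⟨by simp, by simp⟩, by simp⟩
    | succ n ih =>
      intro U hUn hU
      have hne : U.Nonempty := Finset.card_pos.1 (by omega)
      obtain ⟨v, hvU, hvmin⟩ := Finset.exists_min_image U (fun w => H.dist w z) hne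
      obtain ⟨hvx, hvr, hvz⟩ := hU v hvU
      obtain ⟨A, hA, hA12⟩ := ih (U.erase v) (by rw [Finset.card_erase_of_mem hvU]; omega)
        (fun u hu => hU u (Finset.mem_of_mem_erase hu))
      obtain ⟨w, hvw, -, hlt⟩ := closer_aux H (hHz v hvx hvr) hvz
      have hwU : w ∉ U := fun hw => absurd (hvmin w hw) (by simpa using hlt)
      have hrU : r ∉ U := fun h => (hU r h).2.1 rfl
      let forb : V → Option (Fin k) := fun u =>
        if u = r then (if v = x1 then some (A x2 r) else if v = x2 then some (A x1 r) else none)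
        else if u ∈ U then some (A u v) else none
      obtain ⟨A', hA', hagree, hav⟩ := step_aux G hk hreg A _ hA v (by simp) forb (by
        intro u hu hadj
        have huU : u ∈ U := Finset.mem_of_mem_erase (Finset.mem_coe.1 hu)
        have hur : u ≠ r := fun h => hrU (h ▸ huU)
        simp [forb, hur, huU]) (by
        rintro ⟨c, hc⟩
        have := hc w hvw.1
        simp [forb, hvw.2.2, hwU] at this)
      refine ⟨A', ?_, ?_⟩
      · have : (insert v ((U.erase v : Finset V) : Set V)) = (U : Set V) := by
          rw [← Finset.coe_insert, Finset.insert_erase hvU]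
        rwa [this] at hA'
      · intro m1 m2
        by_cases e1 : v = x1
        · have e2 : x2 ≠ v := by rw [e1]; exact h12.symm
          have := hav r (e1 ▸ hx1.symm)
          simp only [forb, if_true, if_pos e1] at this
          rw [hagree x2 e2, ← e1]
          intro hh
          exact this (by rw [hh])
        · by_cases e2 : v = x2
          · have := hav r (e2 ▸ hx2.symm)
            simp only [forb, if_true, if_neg e1, if_pos e2] at this
            rw [hagree x1 (Ne.symm e1), ← e2]
            intro hh
            exact this (by rw [hh])
          · rw [hagree x1 (Ne.symm e1), hagree x2 (Ne.symm e2)]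
            exact hA12 (Finset.mem_erase.2 ⟨Ne.symm e1, m1⟩) (Finset.mem_erase.2 ⟨Ne.symm e2, m2⟩)
  let U : Finset V := Finset.univ.filter (fun w => G.Reachable w x ∧ w ≠ r ∧ w ≠ z)
  obtain ⟨A, hA, hA12⟩ := main _ U rfl (fun u hu => by simpa [U] using hu)
  have hrU : r ∉ U := by simp [U]
  have hzU : z ∉ U := by simp [U]
  have m1 : x1 ∈ U := by
    simp only [U, Finset.mem_filter, Finset.mem_univ, true_and]
    exact ⟨hx1.symm.reachable.trans hrx, hx1.ne', h1z⟩
  have m2 : x2 ∈ U := by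
    simp only [U, Finset.mem_filter, Finset.mem_univ, true_and]
    exact ⟨hx2.symm.reachable.trans hrx, hx2.ne', h2z⟩
  obtain ⟨B, hB, hBA, -⟩ := step_aux G hk hreg A _ hA z (by simpa using hzU)
    (fun u => if u ∈ U then some (A u z) else none)
    (fun u hu _ => if_pos (Finset.mem_coe.1 hu)) (by
      rintro ⟨c, hc⟩
      have := hc r hz.symm
      simp [hrU] at this)
  have hrzU : r ∉ insert z (U : Set V) := by
    simp only [Set.mem_insert_iff, Finset.mem_coe, not_or]
    exact ⟨hz.ne, hrU⟩
  obtain ⟨C, hC, -, -⟩ := step_aux G hk hreg B _ hB r hrzU (fun u => some (B u r))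
    (fun u hu _ => rfl) (by
      rintro ⟨c, hc⟩
      have e1 := Option.some.inj (hc x1 hx1)
      have e2 := Option.some.inj (hc x2 hx2)
      rw [hBA x1 h1z] at e1
      rw [hBA x2 h2z] at e2
      exact hA12 m1 m2 (e1.trans e2.symm))
  have hsub : ∀ w, G.Reachable w x → w ∈ insert r (insert z (U : Set V)) := by
    intro w hw
    by_cases h1 : w = r
    · exact Or.inl h1
    · by_cases h2 : w = z
      · exact Or.inr (Or.inl h2)
      · refine Or.inr (Or.inr ?_)
        simp [U, hw, h1, h2]
  exact ⟨C, fun v hv => hC.1 v (hsub v hv), fun u hu v hv => hC.2 u (hsub u hu) v (hsub v hv)⟩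

theorem global_aux {V : Type*} [Fintype V] (G : SimpleGraph V) [DecidableRel G.Adj]
    {k : ℕ} (hk : 3 ≤ k) (hreg : G.IsRegularOfDegree k) :
    ∃ A : V → V → Fin k, HGood G A Set.univ := by
  choose F hF using fun x => comp_aux G hk hreg x
  let rep : V → V := fun v => (G.connectedComponentMk v).out
  have hrep : ∀ v, G.Reachable v (rep v) := fun v =>
    (SimpleGraph.ConnectedComponent.exact (Quot.out_eq (G.connectedComponentMk v))).symm
  refine ⟨fun v => F (rep v) v, fun v _ a b ha hb hab => (hF (rep v)).1 v (hrep v) a b ha hb hab,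
    fun u _ v _ huv => ?_⟩
  have e : rep u = rep v := by
    have : G.connectedComponentMk u = G.connectedComponentMk v :=
      SimpleGraph.ConnectedComponent.sound huv.reachable
    simp only [rep, this]
  have := (hF (rep u)).2 u (hrep u) v (by rw [e]; exact hrep v) huv
  show F (rep u) u v ≠ F (rep v) v u
  rwa [← e]

theorem stmt_6 {V : Type*} [Fintype V] (G : SimpleGraph V) [DecidableRel G.Adj]
    (k : ℕ) (hk : 3 ≤ k) (hreg : G.IsRegularOfDegree k) :
    ∃ P : Fin (k + 1) → Set (JVert G k),
      (∀ x : JVert G k, ∃! c : Fin (k + 1), x ∈ P c) ∧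
      (∀ c : Fin (k + 1), IsIndepDomSet (JGraph G k) (P c)) := by
  classical
  obtain ⟨A, hinj, hne⟩ := global_aux G hk hreg
  have hinj := fun v => hinj v (Set.mem_univ v)
  have hne := fun u v => hne u (Set.mem_univ u) v (Set.mem_univ v)
  have hsurj : ∀ v (c : Fin k), ∃ w, G.Adj v w ∧ A v w = c := by
    intro v c
    have hN : Fintype.card (G.neighborSet v) = Fintype.card (Fin k) := by
      rw [SimpleGraph.card_neighborSet_eq_degree, Fintype.card_fin]; exact hreg v
    have hb : Function.Bijective (fun w : G.neighborSet v => A v w.1) :=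
      (Fintype.bijective_iff_injective_and_card _).2
        ⟨fun a b hab => Subtype.ext (hinj v _ _ a.2 b.2 hab), hN⟩
    obtain ⟨w, hw⟩ := hb.2 c
    exact ⟨w.1, w.2, hw⟩
  -- colour of half edges
  obtain ⟨B, hB⟩ : ∃ B : V → Sym2 V → Fin (k + 1), ∀ v w, B v s(v, w) = (A v w).castSucc := by
    refine ⟨fun v e => if h : v ∈ e then (A v (Sym2.Mem.other h)).castSucc else 0, fun v w => ?_⟩
    have h : v ∈ s(v, w) := Sym2.mem_mk_left v w
    simp only [dif_pos h]
    have := Sym2.other_spec h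
    rw [Sym2.congr_right.1 this]
  -- colours of copies
  have hcopy : ∀ e : G.edgeSet, ∃ f : Fin (k - 1) → Fin (k + 1), Function.Injective f ∧
      ∀ c, (∃ i, f i = c) ↔ ∀ v ∈ (e : Sym2 V), B v e ≠ c := by
    rintro ⟨e, he⟩
    induction e using Sym2.ind with
    | _ u v =>
      have hadj : G.Adj u v := he
      let T : Finset (Fin (k + 1)) := {B u s(u, v), B v s(u, v)}ᶜ
      have hT : T.card = k - 1 := by
        rw [Finset.card_compl, Finset.card_pair, Fintype.card_fin]
        · omega
        · rw [hB, Sym2.eq_swap, hB]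
          intro h
          exact hne u v hadj (Fin.castSucc_injective _ h)
      refine ⟨T.orderEmbOfFin hT, (T.orderEmbOfFin hT).injective, fun c => ?_⟩
      have : (∃ i, T.orderEmbOfFin hT i = c) ↔ c ∈ T := by
        rw [← Finset.mem_coe, ← Finset.range_orderEmbOfFin T hT]
        rfl
      rw [this]
      simp only [T, Finset.mem_compl, Finset.mem_insert, Finset.mem_singleton, not_or,
        Sym2.mem_iff, forall_eq_or_imp, forall_eq]
      exact ⟨fun h => ⟨fun h' => h.1 h'.symm, fun h' => h.2 h'.symm⟩,
        fun h => ⟨fun h' => h.1 h'.symm, fun h' => h.2 h'.symm⟩⟩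
  choose f hf hfr using hcopy
  let col : JVert G k → Fin (k + 1) := fun x =>
    match x with
    | Sum.inl p => B p.1.1 p.1.2
    | Sum.inr p => f p.1 p.2
  have hBinj : ∀ v (e e' : G.edgeSet), v ∈ (e : Sym2 V) → v ∈ (e' : Sym2 V) →
      B v e = B v e' → e = e' := by
    rintro v ⟨e, he⟩ ⟨e', he'⟩ hv hv' h
    obtain ⟨w, rfl⟩ := hv
    obtain ⟨w', rfl⟩ := hv'
    simp only [hB] at h
    have := hinj v w w' he he' (Fin.castSucc_injective _ h)
    subst this
    rfl
  refine ⟨fun c => {x | col x = c}, fun x => ⟨col x, rfl, fun c hc => hc.symm⟩, fun c => ⟨?_, ?_⟩⟩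
  · intro x hx y hy hxy
    have hcol : col x = col y := Eq.trans hx (Eq.symm hy)
    clear hx hy
    rw [JGraph, SimpleGraph.fromRel_adj] at hxy
    obtain ⟨-, hxy⟩ := hxy
    rcases x with ⟨⟨v, e⟩, hv⟩ | ⟨e, i⟩ <;> rcases y with ⟨⟨w, e'⟩, hw⟩ | ⟨e', j⟩
    · simp only [col] at hcol
      have h1 : v = w ∧ e ≠ e' := by
        rcases hxy with h | h
        · exact h
        · exact ⟨h.1.symm, h.2.symm⟩
      obtain ⟨rfl, h2⟩ := h1
      exact h2 (hBinj v e e' hv hw hcol)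
    · simp only [col] at hcol
      have h1 : e = e' := by
        rcases hxy with h | h <;> exact h
      subst h1
      exact (hfr e _).1 ⟨j, rfl⟩ v hv hcol
    · simp only [col] at hcol
      have h1 : e' = e := by
        rcases hxy with h | h <;> exact h
      subst h1
      exact (hfr e' _).1 ⟨i, rfl⟩ w hw hcol.symm
    · simp only [col] at hcol
      have h1 : e = e' ∧ i ≠ j := by
        rcases hxy with h | h
        · exact h
        · exact ⟨h.1.symm, h.2.symm⟩
      obtain ⟨rfl, h2⟩ := h1
      exact h2 (hf e hcol)
  · intro x hx
    have hx : col x ≠ c := hx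
    suffices h : ∃ y : JVert G k, col y = c ∧ (y ≠ x → (JGraph G k).Adj y x) by
      obtain ⟨y, hy, hyx⟩ := h
      exact ⟨y, hy, hyx (fun h => hx (h ▸ hy))⟩
    rcases x with ⟨⟨v, e⟩, hv⟩ | ⟨e, i⟩
    · rcases Fin.eq_castSucc_or_eq_last c with ⟨c', rfl⟩ | rfl
      · obtain ⟨w, hw, hA⟩ := hsurj v c'
        refine ⟨Sum.inl ⟨(v, ⟨s(v, w), hw⟩), Sym2.mem_mk_left v w⟩, ?_, fun hn => ?_⟩
        · simp only [col, hB, hA]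
        · refine (SimpleGraph.fromRel_adj _ _ _).2 ?_
          refine ⟨hn, Or.inl ⟨rfl, ?_⟩⟩
          intro he
          apply hx
          simp only at he
          subst he
          simp only [col, hB, hA]
      · obtain ⟨i, hi⟩ := (hfr e (Fin.last k)).2 (by
          obtain ⟨e, he⟩ := e
          rintro u ⟨w, rfl⟩
          rw [hB]
          exact Fin.castSucc_ne_last _)
        refine ⟨Sum.inr (e, i), hi, fun hn => ?_⟩
        refine (SimpleGraph.fromRel_adj _ _ _).2 ?_
        exact ⟨hn, Or.inl rfl⟩
    · by_cases hc : ∀ v ∈ (e : Sym2 V), B v e ≠ c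
      · obtain ⟨j, hj⟩ := (hfr e c).2 hc
        refine ⟨Sum.inr (e, j), hj, fun hn => ?_⟩
        refine (SimpleGraph.fromRel_adj _ _ _).2 ?_
        refine ⟨hn, Or.inl ⟨rfl, ?_⟩⟩
        rintro (rfl : j = i)
        exact hn rfl
      · push Not at hc
        obtain ⟨v, hv, hvc⟩ := hc
        refine ⟨Sum.inl ⟨(v, e), hv⟩, hvc, fun hn => ?_⟩
        refine (SimpleGraph.fromRel_adj _ _ _).2 ?_
        exact ⟨hn, Or.inl rfl⟩
end

section
/- Let G be a finite 4-regular simple graph on n ≥ 1 vertices. Define the graph ℋ with vertex set {v' : v ∈ V(G)} ∪ {v_j^k : v ∈ V(G), j ∈ {1,…,n}, k ∈ {1,2,3}} and with the following edges: v' is adjacent to v_j^k for all j, k; v_j^k is adjacent to v_{j'}^{k'} whenever (j,k) ≠ (j',k'); and u_j^k is adjacent to v_{j'}^{k} whenever uv ∈ E(G), for all j, j' ∈ {1,…,n} and k ∈ {1,2,3}. Then the vertex set of ℋ can be partitioned into independent dominating sets of ℋ if and only if G has a proper vertex 3-coloring. -/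
/-- The graph ℋ built from `G` on `n` vertices: for each vertex `v` of `G`, a vertex `v'`
(left summand) and vertices `v_j^k` for `j ∈ [n]`, `k ∈ [3]` (right summand); `v'` is joined
to all `v_j^k`; all `v_j^k`, `v_{j'}^{k'}` with `(j,k) ≠ (j',k')` are joined; and `u_j^k` is
joined to `v_{j'}^k` whenever `uv ∈ E(G)`. -/
def HGraph {V : Type*} (G : SimpleGraph V) (n : ℕ) :
    SimpleGraph (V ⊕ (V × Fin n × Fin 3)) :=
  SimpleGraph.fromRel (fun a b =>
    match a, b with
    | Sum.inl v, Sum.inr ⟨v', _, _⟩ => v = v'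
    | Sum.inr ⟨v, j, k⟩, Sum.inr ⟨v', j', k'⟩ =>
        (v = v' ∧ (j, k) ≠ (j', k')) ∨ (G.Adj v v' ∧ k = k')
    | _, _ => False)

theorem HGraph_inl_inr {V : Type*} (G : SimpleGraph V) (n : ℕ) (v u : V) (j : Fin n) (k : Fin 3) :
    (HGraph G n).Adj (Sum.inl v) (Sum.inr (u, j, k)) ↔ v = u := by
  simp [HGraph]

theorem HGraph_inl_inl {V : Type*} (G : SimpleGraph V) (n : ℕ) (v u : V) :
    ¬ (HGraph G n).Adj (Sum.inl v) (Sum.inl u) := by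
  simp [HGraph]

theorem HGraph_inr_inr {V : Type*} (G : SimpleGraph V) (n : ℕ) (v u : V) (j i : Fin n)
    (k l : Fin 3) :
    (HGraph G n).Adj (Sum.inr (v, j, k)) (Sum.inr (u, i, l)) ↔
      (v = u ∧ (j, k) ≠ (i, l)) ∨ (G.Adj v u ∧ k = l) := by
  have := G.adj_comm u v
  have h := G.ne_of_adj (a := v) (b := u)
  simp only [HGraph, SimpleGraph.fromRel_adj, ne_eq, Sum.inr.injEq, Prod.mk.injEq]
  grind

theorem stmt_9 {V : Type*} [Fintype V] (G : SimpleGraph V) [DecidableRel G.Adj]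
    (hreg : G.IsRegularOfDegree 4) (n : ℕ) (hn : Fintype.card V = n) (hn1 : 1 ≤ n) :
    (∃ (t : ℕ) (P : Fin t → Set (V ⊕ (V × Fin n × Fin 3))),
        (∀ x, ∃! c : Fin t, x ∈ P c) ∧
        (∀ c : Fin t, IsIndepDomSet (HGraph G n) (P c))) ↔
      (∃ f : V → Fin 3, ∀ u v : V, G.Adj u v → f u ≠ f v) := by
  constructor
  · rintro ⟨t, P, hP, hD⟩
    choose c hc hcu using hP
    have hpos : 0 < Fintype.card V := by omega
    obtain ⟨v0⟩ := Fintype.card_pos_iff.mp hpos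
    have hinj : Function.Injective (fun p : Fin n × Fin 3 => c (Sum.inr (v0, p))) := by
      rintro ⟨j, k⟩ ⟨i, l⟩ h
      by_contra hne
      have h1 := hc (Sum.inr (v0, j, k))
      have h2 := hc (Sum.inr (v0, i, l))
      simp only at h
      rw [h] at h1
      exact (hD _).1 _ h1 _ h2 ((HGraph_inr_inr G n _ _ _ _ _ _).2 (Or.inl ⟨rfl, hne⟩))
    have hcard := Fintype.card_le_of_injective _ hinj
    simp only [Fintype.card_prod, Fintype.card_fin] at hcard
    have hns : ¬ Function.Surjective (fun v : V => c (Sum.inl v)) := by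
      intro hs
      have := Fintype.card_le_of_surjective _ hs
      simp only [Fintype.card_fin] at this
      omega
    simp only [Function.Surjective, not_forall, not_exists] at hns
    obtain ⟨d, hd⟩ := hns
    have hnot : ∀ v : V, Sum.inl v ∉ P d := fun v hv => hd v (hcu _ _ hv).symm
    have key : ∀ v : V, ∃ k : Fin 3, ∃ j : Fin n, Sum.inr (v, j, k) ∈ P d := by
      intro v
      obtain ⟨x, hx, hadj⟩ := (hD d).2 _ (hnot v)
      rcases x with u | ⟨u, j, k⟩
      · exact absurd hx (hnot u)
      · have := (HGraph_inl_inr G n _ _ _ _).1 hadj.symm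
        subst this
        exact ⟨k, j, hx⟩
    choose f g hfg using key
    refine ⟨f, fun u v huv h => ?_⟩
    exact (hD d).1 _ (hfg u) _ (hfg v) ((HGraph_inr_inr G n _ _ _ _ _ _).2 (Or.inr ⟨huv, h⟩))
  · rintro ⟨f, hf⟩
    let e := Fintype.equivFin (Option (Fin n × Fin 3))
    let q : V ⊕ (V × Fin n × Fin 3) → Option (Fin n × Fin 3) := fun x =>
      match x with
      | Sum.inl _ => none
      | Sum.inr (v, j, k) => some (j, k - f v)
    refine ⟨_, fun i => {x | q x = e.symm i}, ?_, ?_⟩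
    · intro x
      refine ⟨e (q x), by simp, fun y hy => ?_⟩
      simp only [Set.mem_ofPred_eq] at hy
      simp [hy]
    · intro i
      change IsIndepDomSet (HGraph G n) {x | q x = e.symm i}
      generalize e.symm i = o
      constructor
      · rintro (u | ⟨u, j, k⟩) hu (v | ⟨v, i, l⟩) hv hadj
        · exact HGraph_inl_inl G n _ _ hadj
        · simp only [Set.mem_ofPred_eq, q] at hu hv
          rw [← hu] at hv
          simp at hv
        · simp only [Set.mem_ofPred_eq, q] at hu hv
          rw [← hu] at hv
          simp at hv
        · simp only [Set.mem_ofPred_eq, q] at hu hv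
          rw [← hv] at hu
          simp only [Option.some.injEq, Prod.mk.injEq] at hu
          obtain ⟨h1, h2⟩ := hu
          rcases (HGraph_inr_inr G n _ _ _ _ _ _).1 hadj with ⟨rfl, hne⟩ | ⟨hG, rfl⟩
          · exact hne (by rw [h1, sub_left_injective h2])
          · exact hf _ _ hG (sub_right_injective h2)
      · intro x hx
        rcases o with _ | ⟨i, l⟩
        · rcases x with v | ⟨v, j, k⟩
          · exact absurd rfl hx
          · exact ⟨Sum.inl v, rfl, (HGraph_inl_inr G n _ _ _ _).2 rfl⟩
        · rcases x with v | ⟨v, j, k⟩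
          · exact ⟨Sum.inr (v, i, l + f v), by simp [q],
              ((HGraph_inl_inr G n _ _ _ _).2 rfl).symm⟩
          · refine ⟨Sum.inr (v, i, l + f v), by simp [q],
              (HGraph_inr_inr G n _ _ _ _ _ _).2 (Or.inl ⟨rfl, ?_⟩)⟩
            intro h
            simp only [Prod.mk.injEq] at h
            apply hx
            simp [q, ← h.1, ← h.2]
end

section
/- Let G be a finite 3-regular simple graph and let H be the disjoint union of G and the complete graph K₄. Then the vertex set of G can be partitioned into 1-perfect codes of G if and only if the vertex set of H can be partitioned into independent dominating sets of H. -/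
/-- A 1-perfect code: an independent set such that every vertex outside it is adjacent to
exactly one vertex of it. -/
def IsPerfectCode {W : Type*} (H : SimpleGraph W) (C : Set W) : Prop :=
  (∀ u ∈ C, ∀ v ∈ C, ¬ H.Adj u v) ∧ (∀ v ∉ C, ∃! c : W, c ∈ C ∧ H.Adj v c)

/-- In a partition into independent dominating sets, the neighbours of a vertex meet exactly the
other classes. -/
theorem aux_image {V : Type*} [Fintype V] (G : SimpleGraph V) [DecidableRel G.Adj]
    {t : ℕ} (P : Fin t → Set V) (col : V → Fin t) (hc : ∀ x c, x ∈ P c ↔ col x = c)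
    (hi : ∀ c, ∀ u ∈ P c, ∀ v ∈ P c, ¬ G.Adj u v)
    (hd : ∀ c, ∀ v ∉ P c, ∃ u ∈ P c, G.Adj v u) (v : V) :
    (G.neighborFinset v).image col = Finset.univ.erase (col v) := by
  ext c
  simp only [Finset.mem_image, SimpleGraph.mem_neighborFinset, Finset.mem_erase, Finset.mem_univ,
    and_true]
  constructor
  · rintro ⟨u, hu, rfl⟩ h
    exact hi (col v) v ((hc _ _).2 rfl) u ((hc _ _).2 h) hu
  · intro h
    obtain ⟨u, hu, ha⟩ := hd c v (fun h' => h ((hc _ _).1 h').symm)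
    exact ⟨u, ha, (hc _ _).1 hu⟩

theorem stmt_12 {V : Type*} [Fintype V] (G : SimpleGraph V) [DecidableRel G.Adj]
    (hreg : G.IsRegularOfDegree 3) :
    (∃ (t : ℕ) (P : Fin t → Set V),
        (∀ x : V, ∃! c : Fin t, x ∈ P c) ∧
        (∀ c : Fin t, IsPerfectCode G (P c))) ↔
      (∃ (t : ℕ) (Q : Fin t → Set (V ⊕ Fin 4)),
        (∀ x : V ⊕ Fin 4, ∃! c : Fin t, x ∈ Q c) ∧
        (∀ c : Fin t, IsIndepDomSet (G ⊕g (⊤ : SimpleGraph (Fin 4))) (Q c))) := by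
  constructor
  · rintro ⟨t, P, hP, hC⟩
    have key : ∃ P : Fin 4 → Set V, (∀ x : V, ∃! c, x ∈ P c) ∧ ∀ c, IsPerfectCode G (P c) := by
      rcases isEmpty_or_nonempty V with hV | ⟨⟨v⟩⟩
      · exact ⟨fun _ => ∅, fun x => hV.elim x, fun c => ⟨fun x => hV.elim x, fun x => hV.elim x⟩⟩
      · choose col h1 h2 using hP
        have hc : ∀ x c, x ∈ P c ↔ col x = c :=
          fun x c => ⟨fun h => (h2 x c h).symm, fun h => h ▸ h1 x⟩
        have him := aux_image G P col hc (fun c => (hC c).1)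
          (fun c v hv => ((hC c).2 v hv).exists) v
        have hinj : Set.InjOn col (G.neighborFinset v : Set V) := by
          intro a ha b hb hab
          simp only [SimpleGraph.coe_neighborFinset, SimpleGraph.mem_neighborSet] at ha hb
          have hv : v ∉ P (col a) := fun h => (hC _).1 v h a (h1 a) ha
          exact ((hC _).2 v hv).unique ⟨h1 a, ha⟩ ⟨(hc _ _).2 hab.symm, hb⟩
        have hcard := congrArg Finset.card him
        rw [Finset.card_image_of_injOn hinj, G.card_neighborFinset_eq_degree, hreg v,
          Finset.card_erase_of_mem (Finset.mem_univ _), Finset.card_univ, Fintype.card_fin] at hcard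
        obtain rfl : t = 4 := by omega
        exact ⟨P, fun x => ⟨col x, h1 x, h2 x⟩, hC⟩
    obtain ⟨P, hP, hC⟩ := key
    refine ⟨4, fun c => {x | Sum.elim (fun v => v ∈ P c) (fun k => k = c) x}, ?_, ?_⟩
    · rintro (x | x)
      · exact hP x
      · exact ⟨x, rfl, fun y hy => Eq.symm hy⟩
    · intro c
      refine ⟨?_, ?_⟩
      · rintro (u | u) hu (v | v) hv
        · simpa using (hC c).1 u hu v hv
        · simp
        · simp
        · have h1 : u = c := hu
          have h2 : v = c := hv
          simp [h1, h2]
      · rintro (v | v) hv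
        · obtain ⟨u, hu, ha⟩ := ((hC c).2 v hv).exists
          exact ⟨Sum.inl u, hu, by simpa using ha.symm⟩
        · refine ⟨Sum.inr c, rfl, ?_⟩
          have h1 : ¬ v = c := hv
          simpa using fun h => h1 h.symm
  · rintro ⟨t, Q, hQ, hD⟩
    choose col h1 h2 using hQ
    have hc : ∀ x c, x ∈ Q c ↔ col x = c :=
      fun x c => ⟨fun h => (h2 x c h).symm, fun h => h ▸ h1 x⟩
    have hbij : Function.Bijective (fun k : Fin 4 => col (Sum.inr k)) := by
      constructor
      · intro a b hab
        by_contra hne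
        exact (hD _).1 (Sum.inr a) (h1 _) (Sum.inr b) ((hc _ _).2 hab.symm) (by simpa using hne)
      · intro c
        by_cases h0 : (Sum.inr 0 : V ⊕ Fin 4) ∈ Q c
        · exact ⟨0, (hc _ _).1 h0⟩
        · obtain ⟨u | u, hu, ha⟩ := (hD c).2 _ h0
          · simp at ha
          · exact ⟨u, (hc _ _).1 hu⟩
    have ht := Fintype.card_of_bijective hbij
    simp only [Fintype.card_fin] at ht
    subst ht
    have hi : ∀ c, ∀ u ∈ Sum.inl ⁻¹' Q c, ∀ v ∈ Sum.inl ⁻¹' Q c, ¬ G.Adj u v := by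
      intro c u hu v hv h
      exact (hD c).1 _ hu _ hv (by simpa using h)
    have hd : ∀ c, ∀ v ∉ Sum.inl ⁻¹' Q c, ∃ u ∈ Sum.inl ⁻¹' Q c, G.Adj v u := by
      intro c v hv
      obtain ⟨u | u, hu, ha⟩ := (hD c).2 _ hv
      · exact ⟨u, hu, by simpa using ha.symm⟩
      · simp at ha
    refine ⟨4, fun c => Sum.inl ⁻¹' Q c, fun x => ⟨col (Sum.inl x), h1 _, h2 _⟩, ?_⟩
    intro c
    refine ⟨hi c, fun v hv => ?_⟩
    obtain ⟨u, hu, ha⟩ := hd c v hv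
    refine ⟨u, ⟨hu, ha⟩, ?_⟩
    rintro w ⟨hw, hwa⟩
    have him := aux_image G (fun c => Sum.inl ⁻¹' Q c) (fun x => col (Sum.inl x))
      (fun x c => hc _ _) hi hd v
    have hinj : Set.InjOn (fun x => col (Sum.inl x)) (G.neighborFinset v : Set V) := by
      apply Finset.card_image_iff.1
      rw [him, G.card_neighborFinset_eq_degree, hreg v,
        Finset.card_erase_of_mem (Finset.mem_univ _), Finset.card_univ, Fintype.card_fin]
    exact hinj (by simpa using hwa) (by simpa using ha)
      (((hc _ _).1 hw).trans ((hc _ _).1 hu).symm)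
end
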